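/- There is no pair (X₀, R₀), where X₀ is a Polish space and R₀ is an analytic graph on X₀, such that for every Polish space X and every analytic graph A on X exactly one of the following holds: (a) there is a Borel map c : X → ω with c(x) ≠ c(y) whenever (x,y) ∈ A; (b) there is an injective continuous map u : X₀ → X with R₀ ⊆ (u×u)⁻¹(A). -/

import Mathlib

open Set Topology

abbrev Cantor : Type := ℕ → Bool

/-- `A ⊆ X × Y` is potentially closed (`pot(Π⁰₁)`): there are finer Polish topologies on `X`
and `Y` making `A` closed in the product. -/
def PotClosed {X Y : Type} (tX : TopologicalSpace X) (tY : TopologicalSpace Y)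
    (A : Set (X × Y)) : Prop :=
  ∃ (σ : TopologicalSpace X) (τ : TopologicalSpace Y),
    σ ≤ tX ∧ τ ≤ tY ∧ @PolishSpace X σ ∧ @PolishSpace Y τ ∧
    @IsClosed (X × Y) (@instTopologicalSpaceProd X Y σ τ) A

/-- Membership in the class `D₂(Σ⁰₁)`: difference of two open sets. -/
def D2Sigma01 {Z : Type} (t : TopologicalSpace Z) (A : Set Z) : Prop :=
  ∃ U V : Set Z, @IsOpen Z t U ∧ @IsOpen Z t V ∧ A = U \ V

/-- The rectangular continuous reducibility `A ≤ʳ_c A'`. -/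
def RedRC {X Y X' Y' : Type} (tX : TopologicalSpace X) (tY : TopologicalSpace Y)
    (tX' : TopologicalSpace X') (tY' : TopologicalSpace Y')
    (A : Set (X × Y)) (A' : Set (X' × Y')) : Prop :=
  ∃ (u : X → X') (v : Y → Y'),
    @Continuous X X' tX tX' u ∧ @Continuous Y Y' tY tY' v ∧
    A = (fun p => (u p.1, v p.2)) ⁻¹' A'

/-- `≤ʳ_c` on subsets of `Cantor × Cantor` with the standard topology. -/
def RedC2 (A A' : Set (Cantor × Cantor)) : Prop :=
  RedRC inferInstance inferInstance inferInstance inferInstance A A'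

/-- `A` is `≤ʳ_c`-minimal among non-potentially closed Borel sets. -/
def MinNonPotClosed {X Y : Type} (tX : TopologicalSpace X) (tY : TopologicalSpace Y)
    (A : Set (X × Y)) : Prop :=
  ¬ PotClosed tX tY A ∧
  ∀ (X' Y' : Type) (tX' : TopologicalSpace X') (tY' : TopologicalSpace Y'),
    @PolishSpace X' tX' → @PolishSpace Y' tY' →
    ∀ A' : Set (X' × Y'),
      @MeasurableSet (X' × Y') (@borel (X' × Y') (@instTopologicalSpaceProd X' Y' tX' tY')) A' →
      ¬ PotClosed tX' tY' A' →
      RedRC tX' tY' tX tY A' A → RedRC tX tY tX' tY' A A'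

/-- The Borel reducibility `A ≤_B A'` for square sets. -/
def RedB {Z Z' : Type} (tZ : TopologicalSpace Z) (tZ' : TopologicalSpace Z')
    (A : Set (Z × Z)) (A' : Set (Z' × Z'))  : Prop :=
  ∃ u : Z → Z', @Measurable Z Z' (@borel Z tZ) (@borel Z' tZ') u ∧
    A = (fun p => (u p.1, u p.2)) ⁻¹' A'

/-- `A` is `≤_B`-minimal among non-potentially closed Borel (square) sets. -/
def MinBNonPotClosed {Z : Type} (tZ : TopologicalSpace Z) (A : Set (Z × Z)) : Prop :=
  ¬ PotClosed tZ tZ A ∧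
  ∀ (Z' : Type) (tZ' : TopologicalSpace Z'), @PolishSpace Z' tZ' →
    ∀ A' : Set (Z' × Z'),
      @MeasurableSet (Z' × Z') (@borel (Z' × Z') (@instTopologicalSpaceProd Z' Z' tZ' tZ')) A' →
      ¬ PotClosed tZ' tZ' A' →
      RedB tZ' tZ A' A → RedB tZ tZ' A A'

/-- The graph of the partial function `f` with domain `D`. -/
def graphRel {X : Type} (D : Set X) (f : X → X) : Set (X × X) :=
  {p | p.1 ∈ D ∧ p.2 = f p.1}

/-- `A^f := ⋃ₙ Graph(fₙ)`. -/
def unionGraphs {X : Type} (D : ℕ → Set X) (f : ℕ → X → X) : Set (X × X) :=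
  ⋃ n, graphRel (D n) (f n)

/-- `f` restricted to `D` is a partial homeomorphism with clopen domain and clopen range. -/
def IsPartialHomeo {X : Type} (t : TopologicalSpace X) (D : Set X) (f : X → X) : Prop :=
  @IsClopen X t D ∧ @IsClopen X t (f '' D) ∧ @ContinuousOn X X t t f D ∧
    ∃ g : X → X, @ContinuousOn X X t t g (f '' D) ∧ ∀ x ∈ D, g (f x) = x

/-- A converging situation: a nonempty zero-dimensional perfect Polish space together with
partial homeomorphisms with clopen domains and ranges such that
`Δ(X) = closure(A^f) \ A^f`. -/
def ConvSit (X : Type) (t : TopologicalSpace X) (D : ℕ → Set X) (f : ℕ → X → X) : Prop :=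
  Nonempty X ∧ @PolishSpace X t ∧
  @TopologicalSpace.IsTopologicalBasis X t {s : Set X | @IsClopen X t s} ∧
  @Perfect X t Set.univ ∧
  (∀ n, IsPartialHomeo t (D n) (f n)) ∧
  Set.diagonal X =
    @closure (X × X) (@instTopologicalSpaceProd X X t t) (unionGraphs D f) \ unionGraphs D f

/-- The domain of the restriction `f^B` of the partial map `(D, f)` to a subset `B`. -/
def subD {X : Type} (B : Set X) (D : Set X) (f : X → X) : Set ↥B :=
  {x | (x : X) ∈ D ∧ f (x : X) ∈ B}

/-- The restriction `f^B` of `f` to `B`, as a map of the subtype (junk value outside). -/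
noncomputable def subF {X : Type} (B : Set X) (f : X → X) : ↥B → ↥B :=
  fun x =>
    letI := Classical.dec (f (x : X) ∈ B)
    if h : f (x : X) ∈ B then ⟨f (x : X), h⟩ else x

/-- `A^f ∩ B²`, viewed on the subtype `B`: the union of the graphs of the `f^B_n`'s. -/
def restrGraphs {X : Type} (B : Set X) (D : ℕ → Set X) (f : ℕ → X → X) : Set (↥B × ↥B) :=
  unionGraphs (fun n => subD B (D n) (f n)) (fun n => subF B (f n))

/-- The subspace topology on `B` induced by a topology `t` on `X`. -/
def subTop {X : Type} (t : TopologicalSpace X) (B : Set X) : TopologicalSpace ↥B :=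
  @TopologicalSpace.induced ↥B X Subtype.val t

/-- The natural bijection `ψ : ω → 2^{<ω}` (enumeration by length, then lexicographically):
`ψ(n)` is the binary expansion of `n+1` with its leading one removed. -/
def psiSeq (n : ℕ) : List Bool := ((n + 1).bits.dropLast).reverse

/-- `s_n := ψ(n)0^{n-|ψ(n)|}`, a dense sequence with `|s_n| = n`. -/
def sSeq (n : ℕ) : List Bool := psiSeq n ++ List.replicate (n - (psiSeq n).length) false

/-- The concatenation `sγ` of a finite sequence `s` with `γ ∈ 2^ω`. -/
def catSeq (s : List Bool) (γ : Cantor) : Cantor :=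
  fun i => if h : i < s.length then s.get ⟨i, h⟩ else γ (i - s.length)

/-- `A₁ := {(s_n0γ, s_n1γ) : n ∈ ω, γ ∈ 2^ω}`. -/
def A1 : Set (Cantor × Cantor) :=
  {p | ∃ (n : ℕ) (γ : Cantor),
    p.1 = catSeq (sSeq n ++ [false]) γ ∧ p.2 = catSeq (sSeq n ++ [true]) γ}

/-- `Card(x↾n)`: the number of ones among the first `n` coordinates of `x`. -/
def cardOnes (x : Cantor) (n : ℕ) : ℕ := ∑ i ∈ Finset.range n, (if x i then 1 else 0)

/-- The domain of `f^S_n`: sequences vanishing at `n` whose first `n` coordinates contain a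
number of ones belonging to `S`. -/
def DSdom (S : Set ℕ) (n : ℕ) : Set Cantor := {x | x n = false ∧ cardOnes x n ∈ S}

/-- `f^S_n (s0γ) := s1γ`: flip the `n`-th coordinate to one. -/
def fSfun (n : ℕ) : Cantor → Cantor := fun x => Function.update x n true

/-- `A^S := {(s0γ, s1γ) : s ∈ 2^{<ω}, Card(s) ∈ S, γ ∈ 2^ω} = ⋃ₙ Graph(f^S_n)`. -/
def ASet (S : Set ℕ) : Set (Cantor × Cantor) := unionGraphs (DSdom S) fSfun

/-- Condition (M) on `S ⊆ ω`. -/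
def CondM (S : Set ℕ) : Prop :=
  ∀ p : ℕ, ∃ k : ℕ, ∀ q : ℕ, ∃ c : ℕ, q ≤ c ∧ c ≤ q + k ∧
    (fun m => c + m) '' (S ∩ Set.Iic p) = S ∩ Set.Icc c (c + p)

/-- Condition (H) on `S ⊆ ω`. -/
def CondH (S : Set ℕ) : Prop :=
  ∀ C : Set Cantor, @MeasurableSet Cantor (borel Cantor) C →
    ∀ σ : TopologicalSpace ↥C, σ ≤ subTop inferInstance C →
      ConvSit ↥C σ (fun n => subD C (DSdom S n) (fSfun n)) (fun n => subF C (fSfun n)) →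
      ∀ l p : ℕ, ∃ n : ℕ, l ≤ n ∧ ∃ γ : ↥C, γ ∈ subD C (DSdom S n) (fSfun n) ∧
        (fun m => cardOnes (γ : Cantor) n + m) '' (S ∩ Set.Iic p) =
          S ∩ Set.Icc (cardOnes (γ : Cantor) n) (cardOnes (γ : Cantor) n + p)

/-- Condition (⊥) on a pair `(S, S')`. -/
def CondPerp (S S' : Set ℕ) : Prop :=
  ∃ p : ℕ, ∀ c : ℕ, (fun m => c + m) '' (S ∩ Set.Iic p) ≠ S' ∩ Set.Icc c (c + p)

/-- Condition (⊥⁻¹) on a pair `(S, S')` (stated in `ℤ` to handle subtraction). -/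
def CondPerpInv (S S' : Set ℕ) : Prop :=
  ∃ p : ℕ, ∀ c : ℕ,
    (fun m : ℕ => (c : ℤ) - (m : ℤ)) '' (S ∩ Set.Iic p) ≠
      ((fun n : ℕ => (n : ℤ)) '' S') ∩ Set.Icc ((c : ℤ) - (p : ℤ)) (c : ℤ)

/-- `A⁻¹ := {(y,x) : (x,y) ∈ A}`. -/
def invRel {X : Type} (A : Set (X × X)) : Set (X × X) := {p | (p.2, p.1) ∈ A}

/-- `γ_α`: `γ_α(4n+2ε) = ε` and `γ_α(2n+1) = α(n)`. -/
def gammaSeq (α : Cantor) (k : ℕ) : Bool :=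
  if k % 2 = 1 then α (k / 2) else decide (k % 4 = 2)

/-- `β_α(i) := γ_α((i)₀)` where `(i)₀ = max {m : 2^m ∣ i+1}`, with values in `{0,1} ⊆ ω`. -/
def betaSeq (α : Cantor) (i : ℕ) : ℕ :=
  if gammaSeq α ((i + 1).factorization 2) then 1 else 0

/-- `S_β := {Σ_{i<l} (1 + β(i)) : l ∈ ω}`. -/
def Sbeta (β : ℕ → ℕ) : Set ℕ :=
  {m | ∃ l : ℕ, m = ∑ i ∈ Finset.range l, (1 + β i)}

/-- `s_n` as a function `ℕ → Bool` (with junk value `false` beyond `n`). -/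
def sSeqFn (n : ℕ) (i : ℕ) : Bool := (sSeq n).getD i false

/-- The domain of `f¹_n` (direction `d = true`) or of `(f¹_n)⁻¹` (direction `d = false`):
`x` extends `s_n` and `x(n) = !d`. -/
def step1Dom (n : ℕ) (d : Bool) : Set Cantor :=
  {x | (∀ i, i < n → x i = sSeqFn n i) ∧ x n = !d}

/-- `f¹_n` (if `d = true`) or its inverse (if `d = false`): set the `n`-th coordinate to `d`. -/
def step1Fun (n : ℕ) (d : Bool) : Cantor → Cantor := fun x => Function.update x n d

/-- Domain of `fₙ` (direction `d = true`) or of `fₙ⁻¹` (direction `d = false`). -/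
def stepDom {X : Type} (D : ℕ → Set X) (f : ℕ → X → X) (n : ℕ) (d : Bool) : Set X :=
  if d then D n else f n '' D n

/-- `fₙ` (direction `d = true`) or its inverse `gₙ` (direction `d = false`). -/
def stepFun {X : Type} (f g : ℕ → X → X) (n : ℕ) (d : Bool) : X → X :=
  if d then f n else g n

/-- An acyclic situation (Definition 26), with `g n` the inverse of `f n`. -/
def AcyclicSit (X : Type) (t : TopologicalSpace X) (D : ℕ → Set X) (f g : ℕ → X → X) : Prop :=
  Nonempty X ∧ @PolishSpace X t ∧
  @TopologicalSpace.IsTopologicalBasis X t {s : Set X | @IsClopen X t s} ∧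
  @Perfect X t Set.univ ∧
  (∀ n, IsPartialHomeo t (D n) (f n)) ∧
  (∀ n, ∀ x ∈ D n, g n (f n x) = x) ∧
  Set.diagonal X ⊆
    @closure (X × X) (@instTopologicalSpaceProd X X t t) (unionGraphs D f) \ unionGraphs D f ∧
  (∀ m : ℕ, 1 ≤ m → ∀ (v : ℕ → ℕ) (ε : ℕ → Bool),
    (∀ i, i + 1 < m → v i ≠ v (i + 1) ∨ ε i = ε (i + 1)) →
    ∀ U : Set X, @IsClopen X t U → U.Nonempty →
      ∃ V : Set X, @IsClopen X t V ∧ V.Nonempty ∧ V ⊆ U ∧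
        ∀ x ∈ V, ∀ w : ℕ → X, w 0 = x →
          (∀ i, i < m → w i ∈ stepDom D f (v i) (ε i) ∧
            w (i + 1) = stepFun f g (v i) (ε i) (w i)) →
          w m ∉ V)

/-- The relation `ℜ_Θ` on `2^{<ω}`: `e ℜ_Θ e'` iff `e = e'` or
`(e, e') = (θ_n0w, θ_n1w)` for some `n` and `w`. -/
def RTheta (θ : ℕ → List Bool) (e e' : List Bool) : Prop :=
  e = e' ∨ ∃ (n : ℕ) (w : List Bool), e = θ n ++ false :: w ∧ e' = θ n ++ true :: w

/-- The symmetrization `s(ℜ_Θ)`. -/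
def sRTheta (θ : ℕ → List Bool) (e e' : List Bool) : Prop :=
  RTheta θ e e' ∨ RTheta θ e' e

section FunctionGraph

variable {X : Type*}

/-- The graph in which `x` and `y` are adjacent when one is the image of the other under some
`F n`. -/
def functionGraph (F : ℕ → X → X) : Set (X × X) :=
  {p | ∃ n, p.2 = F n p.1 ∨ p.1 = F n p.2}

theorem functionGraph_irrefl {F : ℕ → X → X} (hF : ∀ n x, F n x ≠ x) (x : X) :
    (x, x) ∉ functionGraph F := by
  rintro ⟨n, h | h⟩ <;> exact hF n x h.symm

theorem functionGraph_symm (F : ℕ → X → X) (x y : X) (h : (x, y) ∈ functionGraph F) :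
    (y, x) ∈ functionGraph F := by
  obtain ⟨n, h⟩ := h
  exact ⟨n, h.symm⟩

theorem analyticSet_functionGraph [TopologicalSpace X] [PolishSpace X] {F : ℕ → X → X}
    (hF : ∀ n, Continuous (F n)) : MeasureTheory.AnalyticSet (functionGraph F) := by
  have h : functionGraph F =
      ⋃ n, ({p : X × X | p.2 = F n p.1} ∪ {p : X × X | p.1 = F n p.2}) := by
    ext p
    simp [functionGraph]
  rw [h]
  refine MeasureTheory.AnalyticSet.iUnion fun n => IsClosed.analyticSet ?_
  exact (isClosed_eq continuous_snd ((hF n).comp continuous_fst)).union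
    (isClosed_eq continuous_fst ((hF n).comp continuous_snd))

/-- If the continuous open maps `F n` move some point of every nonempty open set `U` inside `U`,
then their graph has no Borel coloring with countably many colors. -/
theorem functionGraph_not_colorable [TopologicalSpace X] [BaireSpace X] [Nonempty X]
    [MeasurableSpace X] [BorelSpace X] {F : ℕ → X → X} (hc : ∀ n, Continuous (F n))
    (ho : ∀ n, IsOpenMap (F n))
    (hd : ∀ U : Set X, IsOpen U → U.Nonempty → ∃ n, ∃ x ∈ U, F n x ∈ U) :
    ¬ ∃ c : X → ℕ, Measurable c ∧ ∀ x y, (x, y) ∈ functionGraph F → c x ≠ c y := by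
  rintro ⟨c, hcm, hcol⟩
  choose U hUo hU using fun k : ℕ => (hcm (measurableSet_singleton k)).residualEq_isOpen
  have hG : ∀ᶠ x in residual X, ∀ k, x ∈ c ⁻¹' {k} ↔ x ∈ U k :=
    eventually_countable_forall.2 fun k => (hU k).mem_iff
  have hFG (n : ℕ) : ∀ᶠ x in residual X, ∀ k, F n x ∈ c ⁻¹' {k} ↔ F n x ∈ U k :=
    (tendsto_residual_of_isOpenMap (hc n) (ho n)).eventually hG
  obtain ⟨x₀, hx₀⟩ := (dense_of_mem_residual hG).nonempty
  obtain ⟨n, x, hx, hFx⟩ := hd (U (c x₀)) (hUo _) ⟨x₀, (hx₀ _).1 rfl⟩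
  obtain ⟨z, ⟨hz, hFz⟩, hzG, hzFG⟩ := (dense_of_mem_residual (hG.and (hFG n))).inter_open_nonempty
    (U (c x₀) ∩ F n ⁻¹' U (c x₀)) ((hUo _).inter ((hUo _).preimage (hc n))) ⟨x, hx, hFx⟩
  have h₁ : c z = c x₀ := (hzG _).2 hz
  have h₂ : c (F n z) = c x₀ := (hzFG _).2 hFz
  exact hcol z (F n z) ⟨n, Or.inl rfl⟩ (h₁.trans h₂.symm)

theorem exists_mem_image_mem_of_tendsto [TopologicalSpace X] {F : ℕ → X → X}
    (hF : ∀ x, Filter.Tendsto (fun n => F n x) Filter.atTop (𝓝 x)) (U : Set X) (hU : IsOpen U)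
    (hne : U.Nonempty) : ∃ n, ∃ x ∈ U, F n x ∈ U := by
  obtain ⟨x, hx⟩ := hne
  obtain ⟨n, hn⟩ := ((hF x).eventually (hU.mem_nhds hx)).exists
  exact ⟨n, x, hx, hn⟩

end FunctionGraph

section Hamming

/-- Flip the `n`-th coordinate. -/
def flipCoord (n : ℕ) (x : Cantor) : Cantor :=
  Function.update x n (!x n)

theorem flipCoord_apply (n : ℕ) (x : Cantor) (i : ℕ) :
    flipCoord n x i = if i = n then !x i else x i := by
  by_cases h : i = n
  · subst h
    simp [flipCoord]
  · simp [flipCoord, h]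

theorem flipCoord_involutive (n : ℕ) : Function.Involutive (flipCoord n) := by
  intro x
  funext i
  by_cases h : i = n <;> simp [flipCoord_apply, h]

theorem continuous_flipCoord (n : ℕ) : Continuous (flipCoord n) :=
  continuous_id.update n
    ((continuous_of_discreteTopology (f := Bool.not)).comp (continuous_apply n))

theorem isOpenMap_flipCoord (n : ℕ) : IsOpenMap (flipCoord n) :=
  IsOpenMap.of_inverse (continuous_flipCoord n) (flipCoord_involutive n).leftInverse
    (flipCoord_involutive n).rightInverse

theorem flipCoord_ne (n : ℕ) (x : Cantor) : flipCoord n x ≠ x := fun h => by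
  simpa [flipCoord_apply] using congrFun h n

theorem tendsto_flipCoord (x : Cantor) :
    Filter.Tendsto (fun n => flipCoord n x) Filter.atTop (𝓝 x) := by
  refine tendsto_pi_nhds.2 fun i => tendsto_const_nhds.congr' ?_
  filter_upwards [Filter.eventually_gt_atTop i] with n hn
  simp [flipCoord_apply, hn.ne]

theorem mem_functionGraph_flipCoord {x y : Cantor} (h : (x, y) ∈ functionGraph flipCoord) :
    ∃ n, y = flipCoord n x := by
  obtain ⟨n, h | h⟩ := h
  · exact ⟨n, h⟩
  · exact ⟨n, by rw [show x = _ from h, flipCoord_involutive]⟩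

theorem functionGraph_flipCoord_triangle_free {x y z : Cantor}
    (hxy : (x, y) ∈ functionGraph flipCoord) (hyz : (y, z) ∈ functionGraph flipCoord)
    (hxz : (x, z) ∈ functionGraph flipCoord) : False := by
  obtain ⟨a, rfl⟩ := mem_functionGraph_flipCoord hxy
  obtain ⟨b, rfl⟩ := mem_functionGraph_flipCoord hyz
  obtain ⟨d, h⟩ := mem_functionGraph_flipCoord hxz
  have ha := congrFun h a
  have hb := congrFun h b
  have hd := congrFun h d
  simp only [flipCoord_apply] at ha hb hd
  grind

end Hamming

section StemShift

/-- The injection of `ℕ × ℕ` into itself fixing the rows before the `n`-th one and sending all the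
other ones into the `n`-th row. -/
def rowFold (n : ℕ) (p : ℕ × ℕ) : ℕ × ℕ :=
  if p.1 < n then p else (n, Nat.pair (p.1 - n) p.2)

theorem rowFold_of_lt {n : ℕ} {p : ℕ × ℕ} (h : p.1 < n) : rowFold n p = p :=
  if_pos h

theorem rowFold_fst_le (n : ℕ) (p : ℕ × ℕ) : (rowFold n p).1 ≤ n := by
  unfold rowFold
  split_ifs with h
  · exact h.le
  · exact le_rfl

theorem rowFold_self (n : ℕ) : rowFold n (n, 0) = (n, 0) := by
  simp [rowFold, Nat.pair]

theorem rowFold_injective (n : ℕ) : Function.Injective (rowFold n) := by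
  rintro ⟨a, b⟩ ⟨c, d⟩ h
  unfold rowFold at h
  split_ifs at h with h₁ h₂ h₂ <;> simp only [Prod.mk.injEq, Nat.pair_eq_pair, true_and] at h ⊢ <;>
    simp only at h₁ h₂ <;> omega

/-- Reindex along `rowFold n` and flip the coordinate `(n, 0)`. -/
def stemShift (n : ℕ) (x : ℕ × ℕ → Bool) (p : ℕ × ℕ) : Bool :=
  xor (x (rowFold n p)) (decide (p = (n, 0)))

theorem stemShift_of_lt {n : ℕ} (x : ℕ × ℕ → Bool) {p : ℕ × ℕ} (h : p.1 < n) :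
    stemShift n x p = x p := by
  have : p ≠ (n, 0) := by
    rintro rfl
    exact lt_irrefl _ h
  simp [stemShift, rowFold_of_lt h, this]

theorem stemShift_self (n : ℕ) (x : ℕ × ℕ → Bool) : stemShift n x (n, 0) = !x (n, 0) := by
  simp [stemShift, rowFold_self]

theorem stemShift_ne (n : ℕ) (x : ℕ × ℕ → Bool) : stemShift n x ≠ x := fun h => by
  simpa [stemShift_self] using congrFun h (n, 0)

theorem stemShift_stemShift_of_lt {s t : ℕ} (h : s < t) (x : ℕ × ℕ → Bool) :
    stemShift s (stemShift t x) = stemShift s x := by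
  funext p
  rw [stemShift, stemShift_of_lt x ((rowFold_fst_le s p).trans_lt h), stemShift]

theorem continuous_stemShift (n : ℕ) : Continuous (stemShift n) :=
  continuous_pi fun p => (continuous_of_discreteTopology (f := fun b => xor b _)).comp
    (continuous_apply (rowFold n p))

theorem isOpenMap_stemShift (n : ℕ) : IsOpenMap (stemShift n) := by
  refine IsOpenMap.of_sections fun x =>
    ⟨fun y => Function.extend (rowFold n) (fun p => xor (y p) (decide (p = (n, 0)))) x, ?_, ?_, ?_⟩
  · refine (continuous_pi fun p => ?_).continuousAt
    by_cases h : ∃ q, rowFold n q = p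
    · obtain ⟨q, rfl⟩ := h
      simp only [(rowFold_injective n).extend_apply]
      exact (continuous_of_discreteTopology (f := fun b => xor b _)).comp (continuous_apply q)
    · simp only [Function.extend_apply' _ _ _ h]
      exact continuous_const
  · funext p
    by_cases h : ∃ q, rowFold n q = p
    · obtain ⟨q, rfl⟩ := h
      simp [(rowFold_injective n).extend_apply, stemShift]
    · exact Function.extend_apply' _ _ _ h
  · intro y
    funext p
    simp [stemShift, (rowFold_injective n).extend_apply]

theorem tendsto_stemShift (x : ℕ × ℕ → Bool) :
    Filter.Tendsto (fun n => stemShift n x) Filter.atTop (𝓝 x) := by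
  refine tendsto_pi_nhds.2 fun p => tendsto_const_nhds.congr' ?_
  filter_upwards [Filter.eventually_gt_atTop p.1] with n hn
  exact (stemShift_of_lt x hn).symm

end StemShift

section AnalyticGraph

open MeasureTheory

variable {X : Type*} [TopologicalSpace X] [PolishSpace X] {R : Set (X × X)}

theorem analyticSet_inter {s t : Set X} (hs : AnalyticSet s) (ht : AnalyticSet t) :
    AnalyticSet (s ∩ t) := by
  rw [inter_eq_iInter]
  exact AnalyticSet.iInter fun b => by cases b <;> assumption

theorem analyticSet_neighbors (hR : AnalyticSet R) {B : Set X} (hB : AnalyticSet B) :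
    AnalyticSet {y | ∃ x ∈ B, (x, y) ∈ R} := by
  have h : {y | ∃ x ∈ B, (x, y) ∈ R} = Prod.snd '' (Prod.fst ⁻¹' B ∩ R) := by
    ext y
    simp
  rw [h]
  exact (analyticSet_inter (hB.preimage continuous_fst) hR).image_of_continuous continuous_snd

variable [MeasurableSpace X] [BorelSpace X]

/-- An analytic independent set of an analytic graph is contained in a Borel independent set. -/
theorem exists_measurableSet_independent (hR : AnalyticSet R)
    (hsymm : ∀ x y, (x, y) ∈ R → (y, x) ∈ R) {B : Set X} (hB : AnalyticSet B)
    (hind : ∀ x ∈ B, ∀ y ∈ B, (x, y) ∉ R) :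
    ∃ C, B ⊆ C ∧ MeasurableSet C ∧ ∀ x ∈ C, ∀ y ∈ C, (x, y) ∉ R := by
  obtain ⟨C, hBC, hC, hCm⟩ := hB.measurablySeparable (analyticSet_neighbors hR hB) <|
    disjoint_left.2 fun y hy ⟨x, hx, hxy⟩ => hind x hx y hy hxy
  obtain ⟨D, hBD, hD, hDm⟩ := hB.measurablySeparable (analyticSet_neighbors hR hCm.analyticSet) <|
    disjoint_left.2 fun y hy ⟨x, hx, hxy⟩ => disjoint_left.1 hC ⟨y, hy, hsymm x y hxy⟩ hx
  exact ⟨C ∩ D, subset_inter hBC hBD, hCm.inter hDm, fun x hx y hy hxy =>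
    disjoint_left.1 hD ⟨x, hx.1, hxy⟩ hy.2⟩

/-- An analytic graph whose edges all meet some member of a countable family of analytic
independent sets has a Borel coloring with countably many colors. -/
theorem exists_measurable_coloring {ι : Type*} [Countable ι] [Nonempty ι] (hR : AnalyticSet R)
    (hsymm : ∀ x y, (x, y) ∈ R → (y, x) ∈ R) {B : ι → Set X} (hB : ∀ i, AnalyticSet (B i))
    (hind : ∀ i, ∀ x ∈ B i, ∀ y ∈ B i, (x, y) ∉ R)
    (hcover : ∀ x y, (x, y) ∈ R → ∃ i, x ∈ B i ∨ y ∈ B i) :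
    ∃ c : X → ℕ, Measurable c ∧ ∀ x y, (x, y) ∈ R → c x ≠ c y := by
  classical
  choose C hBC hCm hCind using fun i =>
    exists_measurableSet_independent hR hsymm (hB i) (hind i)
  obtain ⟨e, he⟩ := exists_surjective_nat ι
  let E : ℕ → Set X := fun
    | 0 => (⋃ i, C i)ᶜ
    | k + 1 => C (e k)
  have hEm (n : ℕ) : MeasurableSet (E n) := by
    cases n with
    | zero => exact (MeasurableSet.iUnion hCm).compl
    | succ k => exact hCm _
  have hE (x : X) : ∃ n, x ∈ E n := by
    by_cases h : x ∈ ⋃ i, C i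
    · obtain ⟨i, hi⟩ := mem_iUnion.1 h
      obtain ⟨k, rfl⟩ := he i
      exact ⟨k + 1, hi⟩
    · exact ⟨0, h⟩
  have hEind (n : ℕ) (x : X) (hx : x ∈ E n) (y : X) (hy : y ∈ E n) : (x, y) ∉ R := by
    cases n with
    | zero =>
      intro hxy
      obtain ⟨i, hi | hi⟩ := hcover x y hxy
      · exact hx (mem_iUnion.2 ⟨i, hBC i hi⟩)
      · exact hy (mem_iUnion.2 ⟨i, hBC i hi⟩)
    | succ k => exact hCind _ x hx y hy
  refine ⟨fun x : X => Nat.find (hE x), measurable_find (p := fun (x : X) n => x ∈ E n) hE hEm,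
    fun x y hxy h => ?_⟩
  have hy := Nat.find_spec (hE y)
  rw [← show Nat.find (hE x) = Nat.find (hE y) from h] at hy
  exact hEind _ x (Nat.find_spec (hE x)) y hy hxy

/-- A triangle-free analytic graph admitting an injective continuous homomorphism to the graph of
the maps `stemShift n` has a Borel coloring with countably many colors. -/
theorem exists_measurable_coloring_of_stemShift (hR : AnalyticSet R)
    (hsymm : ∀ x y, (x, y) ∈ R → (y, x) ∈ R)
    (htri : ∀ x y z, (x, y) ∈ R → (y, z) ∈ R → (x, z) ∈ R → False)
    {u : X → ℕ × ℕ → Bool} (hu : Continuous u) (hinj : Function.Injective u)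
    (hom : ∀ p ∈ R, (u p.1, u p.2) ∈ functionGraph stemShift) :
    ∃ c : X → ℕ, Measurable c ∧ ∀ x y, (x, y) ∈ R → c x ≠ c y := by
  let S (i : Σ n : ℕ, Fin (n + 1) → Bool) : Set (X × X) :=
    {p | (∀ k : Fin (i.1 + 1), u p.1 (k, 0) = i.2 k) ∧ u p.2 = stemShift i.1 (u p.1)}
  have hS (i) : IsClosed (S i) := by
    have h : S i = (⋂ k : Fin (i.1 + 1), {p : X × X | u p.1 (k, 0) = i.2 k}) ∩
        {p | u p.2 = stemShift i.1 (u p.1)} := by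
      ext p
      simp [S]
    rw [h]
    refine (isClosed_iInter fun k => isClosed_eq ?_ continuous_const).inter (isClosed_eq ?_ ?_)
    · exact (continuous_apply _).comp (hu.comp continuous_fst)
    · exact hu.comp continuous_snd
    · exact (continuous_stemShift _).comp (hu.comp continuous_fst)
  refine exists_measurable_coloring hR hsymm (B := fun i => Prod.fst '' (R ∩ S i))
    (fun i => (analyticSet_inter hR (hS i).analyticSet).image_of_continuous continuous_fst) ?_ ?_
  · have key (i) (x x') (hx : x ∈ Prod.fst '' (R ∩ S i)) (hx' : x' ∈ Prod.fst '' (R ∩ S i))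
        (hR' : (x, x') ∈ R) (t : ℕ) (ht : u x' = stemShift t (u x)) : False := by
      obtain ⟨⟨x, y⟩, ⟨hxy, hσ, hy⟩, rfl⟩ := hx
      obtain ⟨⟨x', y'⟩, ⟨hxy', hσ', hy'⟩, rfl⟩ := hx'
      dsimp only at *
      rcases le_or_gt t i.1 with h | h
      · have h₁ := hσ ⟨t, Nat.lt_succ_of_le h⟩
        have h₂ := hσ' ⟨t, Nat.lt_succ_of_le h⟩
        rw [ht, stemShift_self] at h₂
        simp [h₁] at h₂
      · rw [ht, stemShift_stemShift_of_lt h, ← hy] at hy'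
        obtain rfl := hinj hy'
        exact htri x x' y' hR' hxy' hxy
    intro i x hx x' hx' hR'
    obtain ⟨t, ht | ht⟩ := hom _ hR'
    · exact key i x x' hx hx' hR' t ht
    · exact key i x' x hx' hx (hsymm _ _ hR') t ht
  · intro x y hxy
    obtain ⟨n, h | h⟩ := hom _ hxy
    · exact ⟨⟨n, fun k => u x (k, 0)⟩, Or.inl ⟨(x, y), ⟨hxy, fun _ => rfl, h⟩, rfl⟩⟩
    · exact ⟨⟨n, fun k => u y (k, 0)⟩, Or.inr ⟨(y, x), ⟨hsymm _ _ hxy, fun _ => rfl, h⟩, rfl⟩⟩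

end AnalyticGraph

theorem stmt3 :
    ¬ ∃ (X₀ : Type) (t₀ : TopologicalSpace X₀) (_ : @PolishSpace X₀ t₀)
        (R₀ : Set (X₀ × X₀)),
      @MeasureTheory.AnalyticSet (X₀ × X₀) (@instTopologicalSpaceProd X₀ X₀ t₀ t₀) R₀ ∧
      (∀ x, (x, x) ∉ R₀) ∧ (∀ x y, (x, y) ∈ R₀ → (y, x) ∈ R₀) ∧
      ∀ (X : Type) (tX : TopologicalSpace X), @PolishSpace X tX →
        ∀ A : Set (X × X),
          @MeasureTheory.AnalyticSet (X × X) (@instTopologicalSpaceProd X X tX tX) A →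
          (∀ x, (x, x) ∉ A) → (∀ x y, (x, y) ∈ A → (y, x) ∈ A) →
          Xor'
            (∃ c : X → ℕ, @Measurable X ℕ (@borel X tX) inferInstance c ∧
              ∀ x y, (x, y) ∈ A → c x ≠ c y)
            (∃ u : X₀ → X, @Continuous X₀ X t₀ tX u ∧ Function.Injective u ∧
              ∀ p ∈ R₀, (u p.1, u p.2) ∈ A) := by
  rintro ⟨X₀, t₀, hpol, R, hR, hirr, hsymm, H⟩
  let := borel X₀
  have : BorelSpace X₀ := ⟨rfl⟩
  have hom {X : Type} [TopologicalSpace X] [PolishSpace X] [Nonempty X] {F : ℕ → X → X}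
      (hc : ∀ n, Continuous (F n)) (ho : ∀ n, IsOpenMap (F n)) (hne : ∀ n x, F n x ≠ x)
      (ht : ∀ x, Filter.Tendsto (fun n => F n x) Filter.atTop (𝓝 x)) :
      ∃ u : X₀ → X, Continuous u ∧ Function.Injective u ∧
        ∀ p ∈ R, (u p.1, u p.2) ∈ functionGraph F := by
    let := borel X
    have : BorelSpace X := ⟨rfl⟩
    exact (Xor.or (H X inferInstance inferInstance (functionGraph F) (analyticSet_functionGraph hc)
      (functionGraph_irrefl hne) (functionGraph_symm F))).resolve_left
      (functionGraph_not_colorable hc ho (exists_mem_image_mem_of_tendsto ht))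
  have hpolish {ι : Type} [Countable ι] : PolishSpace (ι → Bool) := by
    have : TopologicalSpace.IsCompletelyMetrizableSpace (ι → Bool) := inferInstance
    infer_instance
  obtain ⟨v, -, -, hv⟩ :=
    hom (X := ℕ → Bool) continuous_flipCoord isOpenMap_flipCoord flipCoord_ne tendsto_flipCoord
  obtain ⟨u, hu, hinj, huR⟩ :=
    hom continuous_stemShift isOpenMap_stemShift stemShift_ne tendsto_stemShift
  have hcol := exists_measurable_coloring_of_stemShift hR hsymm
    (fun x y z hxy hyz hxz =>
      functionGraph_flipCoord_triangle_free (hv _ hxy) (hv _ hyz) (hv _ hxz))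
    hu hinj huR
  rcases H X₀ t₀ hpol R hR hirr hsymm with ⟨-, h⟩ | ⟨-, h⟩
  · exact h ⟨id, continuous_id, Function.injective_id, fun _ hp => hp⟩
  · exact h hcol
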